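/- Assume the COLD setup for some k ≥ 1, fix subsets S, S̄ ⊆ {1,…,k}, and let E split X into sets of size l. Then for every e with P(E=e) > 0, the conditioning event {V_S = 0, V̄_S̄ = 0, E = e} (where 0 denotes the all-zero tuple) has positive probability and P(F = 1 | V_S = 0, V̄_S̄ = 0, E = e) = a_e / (l + a_e). -/

import Mathlib

namespace CIPaper

/-- A bundled probability space. -/
structure ProbSpace where
  carrier : Type
  [inst : MeasurableSpace carrier]
  μ : MeasureTheory.Measure carrier
  [isProb : MeasureTheory.IsProbabilityMeasure μ]

attribute [instance] ProbSpace.inst ProbSpace.isProb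

/-- A bundled finite measurable alphabet, used as value space of auxiliary random variables. -/
structure FinAlphabet where
  carrier : Type
  [fin : Fintype carrier]
  [ms : MeasurableSpace carrier]
  [msc : MeasurableSingletonClass carrier]

attribute [instance] FinAlphabet.fin FinAlphabet.ms FinAlphabet.msc

open MeasureTheory ProbabilityTheory Real

variable {Ω : Type*} [MeasurableSpace Ω] {S T U : Type*}

/-- P(X = x). -/
noncomputable def pr (μ : Measure Ω) (X : Ω → S) (x : S) : ℝ :=
  (μ (X ⁻¹' {x})).toReal

/-- Shannon entropy (base 2) of a finite-valued random variable. -/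
noncomputable def ent (μ : Measure Ω) [Fintype S] (X : Ω → S) : ℝ :=
  (∑ x, Real.negMulLog (pr μ X x)) / Real.log 2

/-- Conditional entropy H(X|Y). -/
noncomputable def condEnt (μ : Measure Ω) [Fintype S] [Fintype T]
    (X : Ω → S) (Y : Ω → T) : ℝ :=
  ent μ (fun ω => (X ω, Y ω)) - ent μ Y

/-- Mutual information I(X;Y). -/
noncomputable def mi (μ : Measure Ω) [Fintype S] [Fintype T]
    (X : Ω → S) (Y : Ω → T) : ℝ :=
  ent μ X + ent μ Y - ent μ (fun ω => (X ω, Y ω))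

/-- Conditional mutual information I(X;Y|Z). -/
noncomputable def cmi (μ : Measure Ω) [Fintype S] [Fintype T] [Fintype U]
    (X : Ω → S) (Y : Ω → T) (Z : Ω → U) : ℝ :=
  ent μ (fun ω => (X ω, Z ω)) + ent μ (fun ω => (Y ω, Z ω))
    - ent μ (fun ω => (X ω, (Y ω, Z ω))) - ent μ Z

/-- The support of a random variable: values of positive probability. -/
def support (μ : Measure Ω) (X : Ω → S) : Set S := {x | 0 < pr μ X x}

/-- X is uniformly distributed over its support. -/
def IsUniform (μ : Measure Ω) (X : Ω → S) : Prop :=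
  ∀ x ∈ support μ X, ∀ y ∈ support μ X, pr μ X x = pr μ X y

/-- X is uniformly distributed over a support of size n. -/
def UniformOn (μ : Measure Ω) (X : Ω → S) (n : ℕ) : Prop :=
  IsUniform μ X ∧ (support μ X).ncard = n

/-- The TRIPLE predicate: pairwise independence plus each variable a function of the
other two. -/
def TRIPLE (μ : Measure Ω) [Fintype S] [Fintype T] [Fintype U]
    (X : Ω → S) (Y : Ω → T) (Z : Ω → U) : Prop :=
  condEnt μ X (fun ω => (Y ω, Z ω)) = 0 ∧ condEnt μ Y (fun ω => (X ω, Z ω)) = 0 ∧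
    condEnt μ Z (fun ω => (X ω, Y ω)) = 0 ∧
    mi μ X Y = 0 ∧ mi μ X Z = 0 ∧ mi μ Y Z = 0

end CIPaper

namespace CIPaper

open MeasureTheory ProbabilityTheory Real

/-- E splits X into sets of size l: E is a function of X and, conditioned on any value e
of positive probability, X is uniform over exactly l values. -/
def Splits {Ω : Type*} [MeasurableSpace Ω] (μ : Measure Ω) {SX SE : Type*}
    [Fintype SX] [Fintype SE] (X : Ω → SX) (E : Ω → SE) (l : ℕ) : Prop :=
  condEnt μ E X = 0 ∧
  ∀ e : SE, 0 < pr μ E e →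
    (∀ x : SX, pr μ (fun ω => (X ω, E ω)) (x, e) = 0 ∨
        pr μ (fun ω => (X ω, E ω)) (x, e) = pr μ E e / l) ∧
    Set.ncard {x : SX | 0 < pr μ (fun ω => (X ω, E ω)) (x, e)} = l

/-- a_e: the number of values x of X compatible with E = e whose label w(x) satisfies
sat(w(x), S, S̄) = 1. -/
noncomputable def aCount {Ω : Type*} [MeasurableSpace Ω] (μ : Measure Ω) {SX SE : Type*}
    (k : ℕ) (X : Ω → SX) (E : Ω → SE) (wfun : SX → (Fin k → Fin 2))
    (S Sb : Finset (Fin k)) (e : SE) : ℕ :=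
  Set.ncard {x : SX | 0 < pr μ (fun ω => (X ω, E ω)) (x, e) ∧
    (∀ i ∈ S, wfun x i = 1) ∧ ∀ i ∈ Sb, wfun x i = 0}

theorem pr_nonneg {Ω : Type*} [MeasurableSpace Ω] (μ : Measure Ω) {A : Type*} (X : Ω → A) (x : A) :
    0 ≤ pr μ X x := ENNReal.toReal_nonneg

/-- Marginalisation over the values of a finite-valued random variable. -/
theorem sum_measureReal_preimage_inter {Ω : Type*} [MeasurableSpace Ω] (μ : Measure Ω)
    [IsFiniteMeasure μ] {B : Type*} [Fintype B] {Y : Ω → B}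
    (hY : ∀ y, MeasurableSet (Y ⁻¹' {y})) (s : Set Ω) :
    ∑ y, μ.real (Y ⁻¹' {y} ∩ s) = μ.real s := by
  have h := sum_measureReal_preimage_singleton (μ := μ.restrict s) Finset.univ (f := Y)
    (fun y _ => hY y)
  simpa [measureReal_restrict_apply, hY] using h

theorem sum_pr_prodMk_right {Ω : Type*} [MeasurableSpace Ω] (μ : Measure Ω) [IsFiniteMeasure μ]
    {A B : Type*} [Fintype B] (X : Ω → A) {Y : Ω → B}
    (hY : ∀ y, MeasurableSet (Y ⁻¹' {y})) (x : A) :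
    ∑ y, pr μ (fun ω => (X ω, Y ω)) (x, y) = pr μ X x := by
  refine Eq.trans (Finset.sum_congr rfl fun y _ => ?_)
    (sum_measureReal_preimage_inter μ hY (X ⁻¹' {x}))
  refine congrArg μ.real ?_
  ext ω
  simp [and_comm]

theorem sum_pr_prodMk_left {Ω : Type*} [MeasurableSpace Ω] (μ : Measure Ω) [IsFiniteMeasure μ]
    {A B : Type*} [Fintype B] (X : Ω → A) {Y : Ω → B}
    (hY : ∀ y, MeasurableSet (Y ⁻¹' {y})) (x : A) :
    ∑ y, pr μ (fun ω => (Y ω, X ω)) (y, x) = pr μ X x := by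
  refine Eq.trans (Finset.sum_congr rfl fun y _ => ?_)
    (sum_measureReal_preimage_inter μ hY (X ⁻¹' {x}))
  refine congrArg μ.real ?_
  ext ω
  simp

/-- If H(E|X) = 0, then every joint event has probability zero or that of the conditioning
event. -/
theorem pr_eq_zero_or_eq_of_condEnt_eq_zero {Ω : Type*} [MeasurableSpace Ω] (μ : Measure Ω)
    [IsFiniteMeasure μ] {A B : Type*} [Fintype A] [Fintype B] {E : Ω → A} {X : Ω → B}
    (hE : ∀ e, MeasurableSet (E ⁻¹' {e})) (h : condEnt μ E X = 0) (e : A) (x : B) :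
    pr μ (fun ω => (E ω, X ω)) (e, x) = 0 ∨ pr μ (fun ω => (E ω, X ω)) (e, x) = pr μ X x := by
  set p : A → B → ℝ := fun e x => pr μ (fun ω => (E ω, X ω)) (e, x) with hp
  have hp0 : ∀ e x, 0 ≤ p e x := fun e x => pr_nonneg μ _ _
  have hsum : ∀ x, ∑ e, p e x = pr μ X x := sum_pr_prodMk_left μ X hE
  have hle : ∀ e x, p e x ≤ pr μ X x := fun e x =>
    hsum x ▸ Finset.single_le_sum (f := fun e => p e x) (fun e _ => hp0 e x) (Finset.mem_univ e)
  have hnonneg : ∀ x e, 0 ≤ p e x * (log (pr μ X x) - log (p e x)) := by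
    intro x e
    rcases (hp0 e x).eq_or_lt with h0 | h0
    · simp [← h0]
    · exact mul_nonneg h0.le (sub_nonneg.2 (log_le_log h0 (hle e x)))
  have hzero : ∑ x, ∑ e, p e x * (log (pr μ X x) - log (p e x)) = 0 := by
    have hlog : log 2 ≠ 0 := (log_pos one_lt_two).ne'
    have h' : ∑ x, ∑ e, negMulLog (p e x) - ∑ x, negMulLog (pr μ X x) = 0 := by
      rw [condEnt, ent, ent, ← sub_div, div_eq_zero_iff, or_iff_left hlog,
        Fintype.sum_prod_type_right] at h
      exact h
    rw [← h', ← Finset.sum_sub_distrib]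
    refine Finset.sum_congr rfl fun x _ => ?_
    rw [negMulLog, ← hsum x, neg_mul, sub_neg_eq_add, Finset.sum_mul, ← Finset.sum_add_distrib]
    refine Finset.sum_congr rfl fun e _ => ?_
    rw [negMulLog]
    ring
  have h1 := (Finset.sum_eq_zero_iff_of_nonneg
    (fun x _ => Finset.sum_nonneg fun e _ => hnonneg x e)).1 hzero x (Finset.mem_univ x)
  have h2 := (Finset.sum_eq_zero_iff_of_nonneg (fun e _ => hnonneg x e)).1 h1 e (Finset.mem_univ e)
  rcases mul_eq_zero.1 h2 with h3 | h3
  · exact Or.inl h3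
  · rcases (hp0 e x).eq_or_lt with h0 | h0
    · exact Or.inl h0.symm
    · exact Or.inr (log_injOn_pos h0 (h0.trans_le (hle e x)) (sub_eq_zero.1 h3).symm)

theorem mul_log_sub_log_add_sub_nonneg {p q : ℝ} (hp : 0 ≤ p) (hq : 0 ≤ q) (h : q = 0 → p = 0) :
    0 ≤ p * (log p - log q) + q - p ∧ (p * (log p - log q) + q - p = 0 → p = q) := by
  rcases hq.eq_or_lt with h0 | h0
  · simp [h h0.symm, ← h0]
  · have key : p * (log p - log q) + q - p = q * InformationTheory.klFun (p / q) := by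
      rcases hp.eq_or_lt with h1 | h1
      · simp [← h1, InformationTheory.klFun]
      · rw [InformationTheory.klFun, log_div h1.ne' h0.ne']
        field_simp
    have hpq : 0 ≤ p / q := div_nonneg hp hq
    rw [key]
    refine ⟨mul_nonneg hq (InformationTheory.klFun_nonneg hpq), fun h2 => ?_⟩
    have h3 := (InformationTheory.klFun_eq_zero_iff hpq).1 ((mul_eq_zero.1 h2).resolve_left h0.ne')
    exact (div_eq_one_iff_eq h0.ne').1 h3

/-- Vanishing conditional mutual information gives conditional independence. -/
theorem pr_mul_pr_eq_of_cmi_eq_zero {Ω : Type*} [MeasurableSpace Ω] (μ : Measure Ω)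
    [IsFiniteMeasure μ] {A B C : Type*} [Fintype A] [Fintype B] [Fintype C]
    {T : Ω → A} {X : Ω → B} {W : Ω → C} (hT : ∀ t, MeasurableSet (T ⁻¹' {t}))
    (hX : ∀ x, MeasurableSet (X ⁻¹' {x})) (h : cmi μ T X W = 0) (t : A) (x : B) (w : C) :
    pr μ (fun ω => (T ω, (X ω, W ω))) (t, (x, w)) * pr μ W w =
      pr μ (fun ω => (T ω, W ω)) (t, w) * pr μ (fun ω => (X ω, W ω)) (x, w) := by
  set p : A → B → C → ℝ := fun t x w => pr μ (fun ω => (T ω, (X ω, W ω))) (t, (x, w)) with hp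
  set a : A → C → ℝ := fun t w => pr μ (fun ω => (T ω, W ω)) (t, w) with ha
  set b : B → C → ℝ := fun x w => pr μ (fun ω => (X ω, W ω)) (x, w) with hb
  set c : C → ℝ := fun w => pr μ W w with hc
  have hp0 : ∀ t x w, 0 ≤ p t x w := fun t x w => pr_nonneg μ _ _
  have ha0 : ∀ t w, 0 ≤ a t w := fun t w => pr_nonneg μ _ _
  have hb0 : ∀ x w, 0 ≤ b x w := fun x w => pr_nonneg μ _ _
  have hc0 : ∀ w, 0 ≤ c w := fun w => pr_nonneg μ _ _
  have hpb : ∀ x w, ∑ t, p t x w = b x w := fun x w =>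
    sum_pr_prodMk_left μ (fun ω => (X ω, W ω)) hT (x, w)
  have hpa : ∀ t w, ∑ x, p t x w = a t w := by
    intro t w
    refine Eq.trans (Finset.sum_congr rfl fun x _ => ?_)
      (sum_pr_prodMk_left μ (fun ω => (T ω, W ω)) hX (t, w))
    refine congrArg μ.real ?_
    ext ω
    simp only [Set.mem_preimage, Set.mem_singleton_iff, Prod.mk.injEq]
    tauto
  have hac : ∀ w, ∑ t, a t w = c w := sum_pr_prodMk_left μ W hT
  have hbc : ∀ w, ∑ x, b x w = c w := sum_pr_prodMk_left μ W hX
  have hple_a : ∀ t x w, p t x w ≤ a t w := fun t x w =>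
    hpa t w ▸ Finset.single_le_sum (f := fun x => p t x w) (fun x _ => hp0 t x w)
      (Finset.mem_univ x)
  have hple_b : ∀ t x w, p t x w ≤ b x w := fun t x w =>
    hpb x w ▸ Finset.single_le_sum (f := fun t => p t x w) (fun t _ => hp0 t x w)
      (Finset.mem_univ t)
  have hble : ∀ x w, b x w ≤ c w := fun x w =>
    hbc w ▸ Finset.single_le_sum (f := fun x => b x w) (fun x _ => hb0 x w) (Finset.mem_univ x)
  set q : A → B → C → ℝ := fun t x w => a t w * b x w / c w with hq
  have hq0 : ∀ t x w, 0 ≤ q t x w := fun t x w =>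
    div_nonneg (mul_nonneg (ha0 t w) (hb0 x w)) (hc0 w)
  have hqp : ∀ t x w, q t x w = 0 → p t x w = 0 := by
    intro t x w h0
    rcases div_eq_zero_iff.1 h0 with h1 | h1
    · rcases mul_eq_zero.1 h1 with h2 | h2
      · exact le_antisymm (h2 ▸ hple_a t x w) (hp0 t x w)
      · exact le_antisymm (h2 ▸ hple_b t x w) (hp0 t x w)
    · exact le_antisymm (h1 ▸ (hple_b t x w).trans (hble x w)) (hp0 t x w)
  have hqsum : ∀ w, ∑ t, ∑ x, q t x w = ∑ t, ∑ x, p t x w := by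
    intro w
    simp only [hq, hpa, ← Finset.sum_div, ← Finset.mul_sum, ← Finset.sum_mul, hac, hbc]
    exact mul_self_div_self _
  have hlogsplit : ∀ t x w, p t x w * (log (p t x w) - log (q t x w)) =
      p t x w * log (p t x w) - p t x w * log (a t w) - p t x w * log (b x w)
        + p t x w * log (c w) := by
    intro t x w
    rcases (hp0 t x w).eq_or_lt with h0 | h0
    · simp [← h0]
    · have hA := h0.trans_le (hple_a t x w)
      have hB := h0.trans_le (hple_b t x w)
      have hC := hB.trans_le (hble x w)
      rw [hq, log_div (mul_pos hA hB).ne' hC.ne', log_mul hA.ne' hB.ne']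
      ring
  have hzero : ∑ w, ∑ t, ∑ x,
      (p t x w * (log (p t x w) - log (q t x w)) + q t x w - p t x w) = 0 := by
    have h' : ∑ w, (∑ t, negMulLog (a t w) + ∑ x, negMulLog (b x w)
        - ∑ t, ∑ x, negMulLog (p t x w) - negMulLog (c w)) = 0 := by
      have hlog : log 2 ≠ 0 := (log_pos one_lt_two).ne'
      rw [cmi, ent, ent, ent, ent, ← add_div, ← sub_div, ← sub_div, div_eq_zero_iff,
        or_iff_left hlog, Fintype.sum_prod_type_right, Fintype.sum_prod_type_right,
        Fintype.sum_prod_type_right, Fintype.sum_prod_type_right] at h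
      rw [Finset.sum_sub_distrib, Finset.sum_sub_distrib, Finset.sum_add_distrib]
      simp_rw [Finset.sum_comm (s := (Finset.univ : Finset A)) (t := (Finset.univ : Finset B))]
      exact h
    rw [← h']
    refine Finset.sum_congr rfl fun w _ => ?_
    have e1 : ∑ t, negMulLog (a t w) = - ∑ t, ∑ x, p t x w * log (a t w) := by
      simp only [negMulLog, ← Finset.sum_mul, hpa, neg_mul, Finset.sum_neg_distrib]
    have e2 : ∑ x, negMulLog (b x w) = - ∑ t, ∑ x, p t x w * log (b x w) := by
      rw [Finset.sum_comm]
      simp only [negMulLog, ← Finset.sum_mul, hpb, neg_mul, Finset.sum_neg_distrib]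
    have e3 : negMulLog (c w) = - ∑ t, ∑ x, p t x w * log (c w) := by
      simp only [negMulLog, ← Finset.sum_mul, hpa, hac, neg_mul]
    have e4 : ∑ t, ∑ x, negMulLog (p t x w) = - ∑ t, ∑ x, p t x w * log (p t x w) := by
      simp only [negMulLog, neg_mul, Finset.sum_neg_distrib]
    simp only [hlogsplit, Finset.sum_sub_distrib, Finset.sum_add_distrib, hqsum, e1, e2, e3, e4]
    ring
  have hnn : ∀ w t x, 0 ≤ p t x w * (log (p t x w) - log (q t x w)) + q t x w - p t x w :=
    fun w t x => (mul_log_sub_log_add_sub_nonneg (hp0 t x w) (hq0 t x w) (hqp t x w)).1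
  have h1 := (Finset.sum_eq_zero_iff_of_nonneg (fun w _ => Finset.sum_nonneg fun t _ =>
    Finset.sum_nonneg fun x _ => hnn w t x)).1 hzero w (Finset.mem_univ w)
  have h2 := (Finset.sum_eq_zero_iff_of_nonneg (fun t _ =>
    Finset.sum_nonneg fun x _ => hnn w t x)).1 h1 t (Finset.mem_univ t)
  have h3 := (Finset.sum_eq_zero_iff_of_nonneg (fun x _ => hnn w t x)).1 h2 x (Finset.mem_univ x)
  have h4 := (mul_log_sub_log_add_sub_nonneg (hp0 t x w) (hq0 t x w) (hqp t x w)).2 h3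
  change p t x w * c w = a t w * b x w
  rcases (hc0 w).eq_or_lt with h5 | h5
  · have hb' : b x w = 0 := le_antisymm (h5 ▸ hble x w) (hb0 x w)
    rw [← h5, hb']
    simp
  · rw [h4, hq]
    field_simp

/-- in the COLD setup, if E splits X into sets of size l, then for every e of
positive probability the event {V_S = 0, V̄_S̄ = 0, E = e} has positive probability and
P(F = 1 | V_S = 0, V̄_S̄ = 0, E = e) = a_e / (l + a_e). -/
theorem stmt_8 {Ω : Type*} [MeasurableSpace Ω] (μ : Measure Ω) [IsProbabilityMeasure μ]
    (k : ℕ) (hk : 1 ≤ k)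
    (F : Ω → Fin 2) (W : Ω → (Fin k → Fin 2))
    (hFm : Measurable F) (hWm : Measurable W)
    (hFunif : ∀ x : Fin 2, pr μ F x = 2⁻¹)
    (hindep : IndepFun F W μ)
    (V Vb : Fin k → Ω → Fin 2)
    (hV : ∀ i ω, V i ω = (1 - W ω i) * F ω)
    (hVb : ∀ i ω, Vb i ω = W ω i * F ω)
    {SX SE : Type*} [Fintype SX] [Fintype SE]
    [MeasurableSpace SX] [MeasurableSingletonClass SX]
    [MeasurableSpace SE] [MeasurableSingletonClass SE]
    (X : Ω → SX) (hXm : Measurable X)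
    (wfun : SX → (Fin k → Fin 2)) (hwfun : μ {ω | W ω = wfun (X ω)} = 1)
    (hcmi : cmi μ (fun ω => ((fun i => V i ω), (fun i => Vb i ω), F ω)) X W = 0)
    (E : Ω → SE) (hEm : Measurable E) (l : ℕ) (hsplit : Splits μ X E l)
    (S Sb : Finset (Fin k)) :
    ∀ e : SE, 0 < pr μ E e →
      0 < (μ {ω | (∀ i ∈ S, V i ω = 0) ∧ (∀ i ∈ Sb, Vb i ω = 0) ∧ E ω = e}).toReal ∧
      (μ ({ω | (∀ i ∈ S, V i ω = 0) ∧ (∀ i ∈ Sb, Vb i ω = 0) ∧ E ω = e} ∩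
            {ω | F ω = 1})).toReal /
          (μ {ω | (∀ i ∈ S, V i ω = 0) ∧ (∀ i ∈ Sb, Vb i ω = 0) ∧ E ω = e}).toReal =
        (aCount μ k X E wfun S Sb e : ℝ) / ((l : ℝ) + (aCount μ k X E wfun S Sb e : ℝ)) := by
  classical
  have hXs : ∀ x, MeasurableSet (X ⁻¹' {x}) := fun x => hXm (measurableSet_singleton x)
  have hEs : ∀ e, MeasurableSet (E ⁻¹' {e}) := fun e => hEm (measurableSet_singleton e)
  have hFs : ∀ f, MeasurableSet (F ⁻¹' {f}) := fun f => hFm (measurableSet_singleton f)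
  have hWs : ∀ w, MeasurableSet (W ⁻¹' {w}) := fun w => hWm (measurableSet_singleton w)
  have hae : ∀ᵐ ω ∂μ, W ω = wfun (X ω) := by
    have hm : MeasurableSet {ω | W ω = wfun (X ω)} := by
      have : {ω | W ω = wfun (X ω)} = ⋃ x, (X ⁻¹' {x} ∩ W ⁻¹' {wfun x}) := by
        ext ω
        simp
      rw [this]
      exact MeasurableSet.iUnion fun x => (hXs x).inter (hWs _)
    exact (prob_compl_eq_zero_iff hm).2 hwfun
  set T : Ω → (Fin k → Fin 2) × (Fin k → Fin 2) × Fin 2 :=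
    fun ω => ((fun i => V i ω), (fun i => Vb i ω), F ω) with hT
  let τ : (Fin k → Fin 2) → Fin 2 → (Fin k → Fin 2) × (Fin k → Fin 2) × Fin 2 :=
    fun w f => ((fun i => (1 - w i) * f), (fun i => w i * f), f)
  have hTτ : ∀ ω, T ω = τ (W ω) (F ω) := by
    intro ω
    simp only [hT, τ, hV, hVb]
  have hTs : ∀ t, MeasurableSet (T ⁻¹' {t}) := by
    intro t
    have : T ⁻¹' {t} = (fun ω => (W ω, F ω)) ⁻¹' {u | τ u.1 u.2 = t} := by
      ext ω
      simp [hTτ]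
    rw [this]
    exact (hWm.prodMk hFm) (Set.toFinite _).measurableSet
  have hTF : ∀ w f ω, (T ω = τ w f ∧ W ω = w) ↔ (F ω = f ∧ W ω = w) := by
    intro w f ω
    constructor
    · rintro ⟨h1, h2⟩
      exact ⟨congrArg (fun t => t.2.2) h1, h2⟩
    · rintro ⟨rfl, rfl⟩
      exact ⟨hTτ ω, rfl⟩
  have hFX : ∀ f x, μ.real (F ⁻¹' {f} ∩ X ⁻¹' {x}) = 2⁻¹ * pr μ X x := by
    intro f x
    have h1 := pr_mul_pr_eq_of_cmi_eq_zero μ hTs hXs hcmi (τ (wfun x) f) x (wfun x)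
    have e1 : pr μ (fun ω => (T ω, (X ω, W ω))) (τ (wfun x) f, (x, wfun x)) =
        μ.real (F ⁻¹' {f} ∩ X ⁻¹' {x}) := by
      refine measureReal_congr ?_
      filter_upwards [hae] with ω hω
      refine propext ?_
      change (T ω, (X ω, W ω)) = (τ (wfun x) f, (x, wfun x)) ↔ F ω = f ∧ X ω = x
      have := hTF (wfun x) f ω
      simp only [Prod.mk.injEq] at this ⊢
      constructor
      · rintro ⟨a, b, c⟩
        exact ⟨(this.1 ⟨a, c⟩).1, b⟩
      · rintro ⟨a, b⟩
        have c : W ω = wfun x := by rw [hω, b]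
        exact ⟨(this.2 ⟨a, c⟩).1, b, c⟩
    have e2 : pr μ (fun ω => (T ω, W ω)) (τ (wfun x) f, wfun x) = 2⁻¹ * pr μ W (wfun x) := by
      have hset : (fun ω => (T ω, W ω)) ⁻¹' {(τ (wfun x) f, wfun x)} =
          F ⁻¹' {f} ∩ W ⁻¹' {wfun x} := by
        ext ω
        simpa using hTF (wfun x) f ω
      have hi := hindep.measure_inter_preimage_eq_mul {f} {wfun x}
        (measurableSet_singleton _) (measurableSet_singleton _)
      rw [pr, hset, hi, ENNReal.toReal_mul, ← hFunif f]
      rfl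
    have e3 : pr μ (fun ω => (X ω, W ω)) (x, wfun x) = pr μ X x := by
      refine measureReal_congr ?_
      filter_upwards [hae] with ω hω
      refine propext ?_
      change (X ω, W ω) = (x, wfun x) ↔ X ω = x
      simp only [Prod.mk.injEq, and_iff_left_iff_imp]
      rintro rfl
      exact hω
    have hle : pr μ X x ≤ pr μ W (wfun x) := by
      rw [← e3]
      refine measureReal_mono fun ω hω => ?_
      exact (Prod.mk.inj hω).2
    rw [e1, e2, e3] at h1
    rcases (pr_nonneg μ W (wfun x)).eq_or_lt with h0 | h0
    · have hx : pr μ X x = 0 := le_antisymm (h0 ▸ hle) (pr_nonneg μ _ _)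
      rw [hx, mul_zero]
      refine le_antisymm ?_ measureReal_nonneg
      exact (measureReal_mono Set.inter_subset_right).trans hx.le
    · refine mul_right_cancel₀ h0.ne' ?_
      rw [h1]
      ring
  have hFXE : ∀ f x e, μ.real (F ⁻¹' {f} ∩ (X ⁻¹' {x} ∩ E ⁻¹' {e})) =
      2⁻¹ * pr μ (fun ω => (X ω, E ω)) (x, e) := by
    intro f x e
    have hset : (fun ω => (E ω, X ω)) ⁻¹' {(e, x)} = X ⁻¹' {x} ∩ E ⁻¹' {e} := by
      ext ω
      simp [and_comm]
    have hset' : (fun ω => (X ω, E ω)) ⁻¹' {(x, e)} = X ⁻¹' {x} ∩ E ⁻¹' {e} := by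
      ext ω
      simp
    have h1 := pr_eq_zero_or_eq_of_condEnt_eq_zero μ hEs hsplit.1 e x
    have h2 : pr μ (fun ω => (X ω, E ω)) (x, e) = μ.real (X ⁻¹' {x} ∩ E ⁻¹' {e}) := by
      rw [pr, hset']
      rfl
    have h3 : pr μ (fun ω => (E ω, X ω)) (e, x) = μ.real (X ⁻¹' {x} ∩ E ⁻¹' {e}) := by
      rw [pr, hset]
      rfl
    rw [h3] at h1
    rw [h2]
    rcases h1 with h1 | h1
    · rw [h1, mul_zero]
      exact le_antisymm ((measureReal_mono Set.inter_subset_right).trans h1.le) measureReal_nonneg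
    · have hnull : μ.real (X ⁻¹' {x} \ E ⁻¹' {e}) = 0 := by
        have h4 := measureReal_inter_add_sdiff (μ := μ) (s := X ⁻¹' {x}) (hEs e)
        rw [h1] at h4
        change pr μ X x + _ = pr μ X x at h4
        linarith
      have h5 := measureReal_inter_add_sdiff (μ := μ) (s := F ⁻¹' {f} ∩ X ⁻¹' {x}) (hEs e)
      have h6 : μ.real ((F ⁻¹' {f} ∩ X ⁻¹' {x}) \ E ⁻¹' {e}) = 0 := by
        refine le_antisymm ((measureReal_mono ?_).trans hnull.le) measureReal_nonneg
        exact Set.sdiff_subset_sdiff_left Set.inter_subset_right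
      rw [h1, ← hFX f x, ← h5, h6, add_zero, Set.inter_assoc]
  intro e he
  obtain ⟨hval, hcard⟩ := hsplit.2 e he
  have hsumE : ∑ x, pr μ (fun ω => (X ω, E ω)) (x, e) = pr μ E e := sum_pr_prodMk_left μ E hXs e
  have hl : 0 < l := by
    rcases Nat.eq_zero_or_pos l with h0 | h0
    · subst h0
      exfalso
      have : ∑ x, pr μ (fun ω => (X ω, E ω)) (x, e) = 0 := by
        refine Finset.sum_eq_zero fun x _ => ?_
        rcases hval x with h1 | h1
        · exact h1
        · simpa using h1
      rw [this] at hsumE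
      exact he.ne hsumE
    · exact h0
  set A : Set Ω := {ω | (∀ i ∈ S, V i ω = 0) ∧ (∀ i ∈ Sb, Vb i ω = 0) ∧ E ω = e} with hA
  let sat : SX → Prop := fun x => (∀ i ∈ S, wfun x i = 1) ∧ ∀ i ∈ Sb, wfun x i = 0
  have hA1 : μ.real (A ∩ {ω | F ω = 1}) =
      2⁻¹ * (aCount μ k X E wfun S Sb e * (pr μ E e / l)) := by
    rw [← sum_measureReal_preimage_inter μ hXs]
    have hterm : ∀ x, μ.real (X ⁻¹' {x} ∩ (A ∩ {ω | F ω = 1})) =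
        if 0 < pr μ (fun ω => (X ω, E ω)) (x, e) ∧ sat x then 2⁻¹ * (pr μ E e / l) else 0 := by
      intro x
      have hcongr : ∀ᵐ ω ∂μ, ω ∈ X ⁻¹' {x} ∩ (A ∩ {ω | F ω = 1}) ↔
          ω ∈ F ⁻¹' {1} ∩ (X ⁻¹' {x} ∩ E ⁻¹' {e}) ∧ sat x := by
        filter_upwards [hae] with ω hω
        have hsub : ∀ u : Fin 2, 1 - u = 0 ↔ u = 1 := by decide
        simp only [A, sat, Set.mem_inter_iff, Set.mem_preimage, Set.mem_singleton_iff,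
          Set.mem_ofPred_eq, hV, hVb]
        constructor
        · rintro ⟨rfl, ⟨h1, h2, h3⟩, h4⟩
          simp only [h4, mul_one, hω, hsub] at h1 h2
          exact ⟨⟨h4, rfl, h3⟩, h1, h2⟩
        · rintro ⟨⟨h4, rfl, h3⟩, h1, h2⟩
          simp only [h4, mul_one, hω, hsub]
          exact ⟨trivial, ⟨h1, h2, h3⟩, trivial⟩
      have hm : μ.real (X ⁻¹' {x} ∩ (A ∩ {ω | F ω = 1})) =
          μ.real {ω | ω ∈ F ⁻¹' {1} ∩ (X ⁻¹' {x} ∩ E ⁻¹' {e}) ∧ sat x} :=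
        measureReal_congr (hcongr.mono fun ω h => propext h)
      rw [hm]
      by_cases hs : sat x
      · simp only [hs, and_true, Set.ofPred_mem_eq, hFXE]
        rcases hval x with h1 | h1
        · simp [h1]
        · split_ifs with h2
          · rw [h1]
          · rw [le_antisymm (not_lt.1 h2) (pr_nonneg μ _ _), mul_zero]
      · simp [hs]
    rw [Finset.sum_congr rfl fun x _ => hterm x, ← Finset.sum_filter, Finset.sum_const,
      nsmul_eq_mul, aCount, Set.ncard_eq_toFinset_card', Set.toFinset_ofPred]
    ring
  have hA0 : μ.real (A \ {ω | F ω = 1}) = 2⁻¹ * pr μ E e := by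
    have hset : A \ {ω | F ω = 1} = F ⁻¹' {0} ∩ E ⁻¹' {e} := by
      ext ω
      have h01 : ∀ u : Fin 2, ¬ u = 1 ↔ u = 0 := by decide
      simp only [A, Set.mem_sdiff, Set.mem_ofPred_eq, hV, hVb, h01, Set.mem_inter_iff,
        Set.mem_preimage, Set.mem_singleton_iff]
      constructor
      · rintro ⟨⟨-, -, h1⟩, h2⟩
        exact ⟨h2, h1⟩
      · rintro ⟨h2, h1⟩
        simp [h1, h2]
    rw [hset, ← sum_measureReal_preimage_inter μ hXs, ← hsumE, Finset.mul_sum]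
    refine Finset.sum_congr rfl fun x _ => ?_
    rw [← hFXE 0 x e, Set.inter_left_comm]
  have hAtot := measureReal_inter_add_sdiff (μ := μ) (s := A) (t := {ω | F ω = 1}) (hFs 1)
  change 0 < μ.real A ∧ μ.real (A ∩ {ω | F ω = 1}) / μ.real A = _
  rw [← hAtot, hA0, hA1]
  have hl' : (0 : ℝ) < l := Nat.cast_pos.2 hl
  have ha' : (0 : ℝ) ≤ aCount μ k X E wfun S Sb e := Nat.cast_nonneg _
  refine ⟨by positivity, ?_⟩
  field_simp
  ring

end CIPaper
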